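/- Let A be a Jacobi-Jordan algebra over a field K of characteristic different from 2 and 3. Then (x·x)·(y·z) + 2·((x·y)·(x·z)) = 0 for all x, y, z ∈ A. -/

import Mathlib

section JacobiJordan

variable {K A : Type*} [Field K] [AddCommGroup A] [Module K A] (mul : A →ₗ[K] A →ₗ[K] A)

theorem jacobiJordan_mul_self_mul_self (h3 : (3 : K) ≠ 0)
    (jacobi : ∀ x y z : A, mul x (mul y z) + mul y (mul z x) + mul z (mul x y) = 0) (x : A) :
    mul x (mul x x) = 0 := by
  refine (smul_eq_zero.mp ?_).resolve_left h3
  linear_combination (norm := module) jacobi x x x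

theorem jacobiJordan_mul_self_mul
    (comm : ∀ x y : A, mul x y = mul y x)
    (jacobi : ∀ x y z : A, mul x (mul y z) + mul y (mul z x) + mul z (mul x y) = 0) (x y : A) :
    mul (mul x x) y = (-2 : K) • mul x (mul x y) := by
  have h := jacobi x x y
  rw [comm y x, comm y (mul x x)] at h
  linear_combination (norm := module) h

theorem jacobiJordan_mul_self_mul_mul (h2 : (2 : K) ≠ 0) (h3 : (3 : K) ≠ 0)
    (comm : ∀ x y : A, mul x y = mul y x)
    (jacobi : ∀ x y z : A, mul x (mul y z) + mul y (mul z x) + mul z (mul x y) = 0) (x y : A) :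
    mul (mul x x) (mul x y) = 0 := by
  have hsq := jacobiJordan_mul_self_mul mul comm jacobi x
  have h := jacobi (mul x x) x y
  rw [comm y (mul x x), comm (mul x x) x, jacobiJordan_mul_self_mul_self mul h3 jacobi x,
    hsq y, map_smul, map_zero, add_zero] at h
  have h' := hsq (mul x y)
  refine (smul_eq_zero.mp ?_).resolve_left h2
  linear_combination (norm := module) h + h'

end JacobiJordan

/-- In a Jacobi-Jordan algebra over a field of characteristic different from `2` and `3`,
`(x·x)·(y·z) + 2·((x·y)·(x·z)) = 0`. -/
theorem jacobiJordan_identity3 {K A : Type*} [Field K]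
    (h2 : (2 : K) ≠ 0) (h3 : (3 : K) ≠ 0)
    [AddCommGroup A] [Module K A] (mul : A →ₗ[K] A →ₗ[K] A)
    (comm : ∀ x y : A, mul x y = mul y x)
    (jacobi : ∀ x y z : A, mul x (mul y z) + mul y (mul z x) + mul z (mul x y) = 0) :
    ∀ x y z : A, mul (mul x x) (mul y z) + (2 : K) • mul (mul x y) (mul x z) = 0 := by
  intro x y z
  have cube := jacobiJordan_mul_self_mul_mul mul h2 h3 comm jacobi
  have hp := cube (x + y) z
  have hm := cube (x - y) z
  have hy := cube y z
  simp only [map_add, map_sub, LinearMap.add_apply, LinearMap.sub_apply, comm y x] at hp hm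
  refine (smul_eq_zero.mp ?_).resolve_left h2
  linear_combination (norm := module) hp - hm - (2 : K) • hy
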